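/- (Whitehead's lemmas) Let g be a finite-dimensional semisimple Lie algebra over a field of characteristic 0 and V a finite-dimensional g-module. Then the first and second Chevalley–Eilenberg cohomology groups with coefficients in V vanish: H¹(g,V) = 0 and H²(g,V) = 0. -/

import Mathlib

/-- The Chevalley–Eilenberg differential (see `stmt_5`). -/
noncomputable def ceD (k : Type*) [Field k] (L : Type*) [LieRing L] [LieAlgebra k L]
    (V : Type*) [AddCommGroup V] [Module k V] [LieRingModule L V]
    (p : ℕ) (ω : (Fin p → L) → V) : (Fin (p + 1) → L) → V :=
  fun x =>
    (∑ i : Fin (p + 1), ((-1 : k) ^ (i : ℕ)) • ⁅x i, ω (fun j => x (i.succAbove j))⁆)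
    + ∑ j : Fin (p + 1), ∑ i : Fin (p + 1),
        if hij : (i : ℕ) < (j : ℕ) then
          ((-1 : k) ^ (j : ℕ)) •
            ω (Function.update (fun l => x (j.succAbove l))
                ⟨(i : ℕ), lt_of_lt_of_le hij (Nat.lt_succ_iff.mp j.isLt)⟩ ⁅x i, x j⁆)
        else 0

namespace Whitehead

open LieAlgebra LieModule

section defs

variable (k : Type*) [Field k] (L : Type*) [LieRing L] [LieAlgebra k L]
    (V : Type*) [AddCommGroup V] [Module k V] [LieRingModule L V]

/-- Vanishing of the first cohomology, curried. -/
def H1 : Prop := ∀ f : L →ₗ[k] V, (∀ x y, f ⁅x, y⁆ = ⁅x, f y⁆ - ⁅y, f x⁆) →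
  ∃ v, ∀ x, f x = ⁅x, v⁆

/-- The curried 2-cocycle condition. -/
def Coc2 (w : L →ₗ[k] L →ₗ[k] V) : Prop :=
  ∀ x y z, ⁅x, w y z⁆ - ⁅y, w x z⁆ + ⁅z, w x y⁆ - w ⁅x, y⁆ z + w ⁅x, z⁆ y + w x ⁅y, z⁆ = 0

/-- Vanishing of the second cohomology, curried. -/
def H2 : Prop := ∀ w : L →ₗ[k] L →ₗ[k] V, (∀ x, w x x = 0) → Coc2 k L V w →
  ∃ g : L →ₗ[k] V, ∀ x y, w x y = ⁅x, g y⁆ - ⁅y, g x⁆ - g ⁅x, y⁆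

end defs

variable {k : Type*} [Field k] {L : Type*} [LieRing L] [LieAlgebra k L]
    {V : Type*} [AddCommGroup V] [Module k V] [LieRingModule L V] [LieModule k L V]

theorem H1_ext (W : LieSubmodule k L V) (h1 : H1 k L W) (h2 : H1 k L (V ⧸ W)) : H1 k L V := by
  intro f hf
  obtain ⟨v', hv⟩ := h2 ((LieSubmodule.Quotient.mk' W : V →ₗ[k] V ⧸ W) ∘ₗ f) (by
    intro x y
    have := congrArg (LieSubmodule.Quotient.mk' W) (hf x y)
    rw [map_sub, LieModuleHom.map_lie, LieModuleHom.map_lie] at this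
    exact this)
  obtain ⟨v, rfl⟩ := LieSubmodule.Quotient.surjective_mk' W v'
  have hm : ∀ x, f x - ⁅x, v⁆ ∈ W := by
    intro x
    rw [← LieSubmodule.Quotient.mk_eq_zero, map_sub, LieModuleHom.map_lie, sub_eq_zero]
    exact hv x
  let f' : L →ₗ[k] W := LinearMap.codRestrict W.toSubmodule 
    (f - (LinearMap.mk₂ k (fun (x : L) (u : V) => ⁅x, u⁆) (by simp) (by simp) (by simp)
      (by simp)).flip v) hm
  have hf' : ∀ x, (f' x : V) = f x - ⁅x, v⁆ := fun x => rfl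
  obtain ⟨u, hu⟩ := h1 f' (by
    intro x y
    apply Subtype.ext
    simp only [AddSubgroupClass.coe_sub, LieSubmodule.coe_bracket, hf', hf, lie_sub, lie_lie]
    abel)
  refine ⟨v + u, fun x => ?_⟩
  have := congrArg (Subtype.val) (hu x)
  rw [hf', LieSubmodule.coe_bracket] at this
  rw [lie_add, ← this]; abel

/-- coboundary of a 1-cochain -/
noncomputable def dd (g : L →ₗ[k] V) : L →ₗ[k] L →ₗ[k] V :=
  LinearMap.mk₂ k (fun x y => ⁅x, g y⁆ - ⁅y, g x⁆ - g ⁅x, y⁆)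
    (by intros; simp; abel) (by intros; simp [smul_sub]) (by intros; simp; abel)
    (by intros; simp [smul_sub])

theorem dd_apply (g : L →ₗ[k] V) (x y : L) : dd g x y = ⁅x, g y⁆ - ⁅y, g x⁆ - g ⁅x, y⁆ := rfl

theorem dd_coc (g : L →ₗ[k] V) : Coc2 k L V (dd g) := by
  intro x y z
  have : g ⁅⁅x, y⁆, z⁆ = g ⁅x, ⁅y, z⁆⁆ - g ⁅y, ⁅x, z⁆⁆ := by rw [← map_sub, lie_lie]
  have h2 : g ⁅⁅x, z⁆, y⁆ = - g ⁅y, ⁅x, z⁆⁆ := by rw [← map_neg, lie_skew]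
  simp only [dd_apply, this, h2, lie_sub]
  rw [lie_lie x y, lie_lie x z, lie_lie y z]
  abel

theorem H2_ext (W : LieSubmodule k L V) (h1 : H2 k L W) (h2 : H2 k L (V ⧸ W)) : H2 k L V := by
  intro w ha hc
  obtain ⟨g', hg⟩ := h2 (w.compr₂ (LieSubmodule.Quotient.mk' W : V →ₗ[k] V ⧸ W)) (by
    intro x; simp [ha]) (by
    intro x y z
    have := congrArg (LieSubmodule.Quotient.mk' W) (hc x y z)
    simp only [map_sub, map_add, LieModuleHom.map_lie, map_zero] at this
    exact this)
  obtain ⟨s, hs⟩ := (LieSubmodule.Quotient.mk' W : V →ₗ[k] V ⧸ W).exists_rightInverse_of_surjective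
    (LinearMap.range_eq_top.2 (LieSubmodule.Quotient.surjective_mk' W))
  have hs' : ∀ q, LieSubmodule.Quotient.mk' W (s q) = q := fun q => LinearMap.congr_fun hs q
  let g := s ∘ₗ g'
  have hm : ∀ x y, (w - dd g) x y ∈ W := by
    intro x y
    rw [← LieSubmodule.Quotient.mk_eq_zero]
    have := hg x y
    simp only [LinearMap.compr₂_apply] at this
    simp only [LinearMap.sub_apply, dd_apply, map_sub, LieModuleHom.map_lie, g, LinearMap.comp_apply,
      hs', sub_eq_zero]
    exact this
  let w' : L →ₗ[k] L →ₗ[k] W := LinearMap.mk₂ k (fun x y => ⟨(w - dd g) x y, hm x y⟩)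
    (by intros; apply Subtype.ext; simp only [map_add, LinearMap.add_apply]; rfl)
    (by intros; apply Subtype.ext; simp only [map_smul, LinearMap.smul_apply]; rfl)
    (by intros; apply Subtype.ext; simp only [map_add]; rfl)
    (by intros; apply Subtype.ext; simp only [map_smul]; rfl)
  have hw' : ∀ x y, (w' x y : V) = w x y - dd g x y := fun x y => rfl
  obtain ⟨u, hu⟩ := h1 w' (by
      intro x
      apply Subtype.ext
      rw [hw', ha, dd_apply]
      simp) (by
    intro x y z
    apply Subtype.ext
    have e1 := hc x y z
    have e2 := dd_coc g x y z
    simp only [LieSubmodule.coe_add, AddSubgroupClass.coe_sub, LieSubmodule.coe_bracket, hw', lie_sub,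
      LieSubmodule.coe_zero]
    rw [← sub_eq_zero.2 (e1.trans e2.symm)]
    abel)
  refine ⟨g + (W.toSubmodule.subtype) ∘ₗ u, fun x y => ?_⟩
  have := congrArg (Subtype.val) (hu x y)
  simp only [AddSubgroupClass.coe_sub, LieSubmodule.coe_bracket, hw', dd_apply] at this
  rw [sub_eq_iff_eq_add] at this
  rw [this]
  simp only [LinearMap.add_apply, lie_add, LinearMap.comp_apply, Submodule.subtype_apply]
  abel

section casimir

variable {ι : Type*} [Fintype ι] (e f : ι → L)

/-- Casimir operator -/
noncomputable def cas (V : Type*) [AddCommGroup V] [Module k V] [LieRingModule L V]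
    [LieModule k L V] : V →ₗ[k] V :=
  ∑ i, (toEnd k L V (e i)) ∘ₗ (toEnd k L V (f i))

theorem cas_apply (v : V) : cas (k := k) e f V v = ∑ i, ⁅e i, ⁅f i, v⁆⁆ := by
  simp [cas]

/-- invariance of the tensor -/
def Inv (k : Type*) [Field k] {L : Type*} [LieRing L] [LieAlgebra k L] {ι : Type*} [Fintype ι]
    (e f : ι → L) (V : Type*) [AddCommGroup V] [Module k V] : Prop :=
  ∀ (F : L →ₗ[k] L →ₗ[k] V) (x : L), ∑ i, (F ⁅x, e i⁆ (f i) + F (e i) ⁅x, f i⁆) = 0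

variable {e f}

theorem cas_comm (hI : Inv k e f V) (x : L) (v : V) :
    cas (k := k) e f V ⁅x, v⁆ = ⁅x, cas (k := k) e f V v⁆ := by
  have := hI (LinearMap.mk₂ k (fun a b => ⁅a, ⁅b, v⁆⁆) (by simp) (by simp) (by simp) (by simp)) x
  rw [cas_apply, cas_apply, lie_sum, eq_comm, ← sub_eq_zero, ← this, ← Finset.sum_sub_distrib]
  refine Finset.sum_congr rfl fun i _ => ?_
  simp only [LinearMap.mk₂_apply, lie_lie, lie_sub]
  abel

theorem H1_cas (hI : Inv k e f V) (hb : Function.Bijective (cas (k := k) e f V)) : H1 k L V := by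
  intro g hg
  have key : ∀ x, ⁅x, ∑ i, ⁅e i, g (f i)⁆⁆ = cas (k := k) e f V (g x) := by
    intro x
    have := hI (LinearMap.mk₂ k (fun a b => ⁅a, g b⁆) (by simp) (by simp) (by simp) (by simp)) x
    rw [cas_apply, lie_sum, ← sub_eq_zero, ← this, ← Finset.sum_sub_distrib]
    refine Finset.sum_congr rfl fun i _ => ?_
    simp only [LinearMap.mk₂_apply, lie_lie, lie_sub, hg]
    abel
  obtain ⟨v, hv⟩ := hb.2 (∑ i, ⁅e i, g (f i)⁆)
  refine ⟨v, fun x => hb.1 ?_⟩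
  rw [← key, ← hv, cas_comm hI]

theorem H2_cas (hI : Inv k e f V) (hb : Function.Bijective (cas (k := k) e f V)) : H2 k L V := by
  intro w ha hc
  let g : L →ₗ[k] V := ∑ i, (toEnd k L V (e i)) ∘ₗ w (f i)
  have hg : ∀ x, g x = ∑ i, ⁅e i, w (f i) x⁆ := by intro x; simp [g]
  have key : ∀ y z, ⁅y, g z⁆ - ⁅z, g y⁆ - g ⁅y, z⁆ = cas (k := k) e f V (w y z) := by
    intro y z
    have h1 := hI (LinearMap.mk₂ k (fun a b => ⁅a, w b z⁆) (by simp) (by simp) (by simp) (by simp)) y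
    have h2 := hI (LinearMap.mk₂ k (fun a b => ⁅a, w b y⁆) (by simp) (by simp) (by simp) (by simp)) z
    rw [cas_apply, hg, hg, hg, lie_sum, lie_sum, ← sub_eq_zero, ← sub_eq_zero.2 (h1.trans h2.symm)]
    simp only [← Finset.sum_sub_distrib]
    refine Finset.sum_congr rfl fun i _ => ?_
    have e1 := congrArg (fun t => ⁅e i, t⁆) (hc (f i) y z)
    have s1 : w ⁅f i, y⁆ z = - w ⁅y, f i⁆ z := by rw [← lie_skew, map_neg, LinearMap.neg_apply]
    have s2 : w ⁅f i, z⁆ y = - w ⁅z, f i⁆ y := by rw [← lie_skew, map_neg, LinearMap.neg_apply]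
    simp only [s1, s2, lie_add, lie_sub, lie_neg, lie_zero] at e1
    simp only [LinearMap.mk₂_apply, lie_lie]
    rw [← sub_eq_zero, ← neg_eq_zero, ← e1]
    abel
  let C := LinearEquiv.ofBijective (cas (k := k) e f V) hb
  have hC : ∀ v, cas (k := k) e f V (C.symm v) = v := fun v => C.apply_symm_apply v
  refine ⟨C.symm.toLinearMap ∘ₗ g, fun x y => hb.1 ?_⟩
  simp only [map_sub, cas_comm hI, LinearMap.comp_apply, LinearEquiv.coe_coe, hC, key]

end casimir

section killing

variable [FiniteDimensional k L] [IsKilling k L]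

theorem perfect : Submodule.span k {m : L | ∃ y z : L, ⁅y, z⁆ = m} = ⊤ := by
  let D : LieIdeal k L := ⁅(⊤ : LieIdeal k L), (⊤ : LieIdeal k L)⁆
  have hD : D.toSubmodule = Submodule.span k {m : L | ∃ y z : L, ⁅y, z⁆ = m} := by
    rw [LieSubmodule.lieIdeal_oper_eq_linear_span]
    congr 1
    ext m
    simp
  rw [← hD]
  have hc := (LieIdeal.isCompl_killingCompl D)
  have hbot : D.killingCompl = ⊥ := by
    rw [LieSubmodule.eq_bot_iff]
    intro x hx
    rw [LieIdeal.mem_killingCompl] at hx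
    have : x ∈ center k L := by
      rw [mem_maxTrivSubmodule]
      intro y
      apply (IsKilling.killingForm_nondegenerate k L).1
      intro z
      rw [← lie_skew, map_neg, LinearMap.neg_apply, traceForm_apply_lie_apply, traceForm_comm, hx, neg_zero]
      exact LieSubmodule.lie_mem_lie (by simp) (by simp)
    rw [center_eq_bot] at this
    simpa using this
  have := hc.sup_eq_top
  rw [hbot, sup_bot_eq] at this
  rw [this]; rfl

theorem H1_triv (ht : ∀ (x : L) (v : V), ⁅x, v⁆ = 0) : H1 k L V := by
  intro f hf
  refine ⟨0, fun x => ?_⟩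
  have : f = 0 := by
    apply LinearMap.ext_on_range (v := fun p : L × L => ⁅p.1, p.2⁆)
    · rw [← perfect (k := k) (L := L)]
      congr 1
      ext m
      simp
    · intro p
      simp [hf, ht]
  simp [this]

theorem H2_triv [FiniteDimensional k V] (ht : ∀ (x : L) (v : V), ⁅x, v⁆ = 0) : H2 k L V := by
  intro w ha hc
  have hsc : ∀ φ : V →ₗ[k] k, ∃ z : L, ∀ x y, φ (w x y) = killingForm k L z ⁅x, y⁆ := by
    intro φ
    have hnd := IsKilling.killingForm_nondegenerate k L
    let E := LinearMap.BilinForm.toDual (killingForm k L) hnd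
    let D : L →ₗ[k] L := E.symm.toLinearMap ∘ₗ (w.compr₂ φ)
    have hD : ∀ x y, killingForm k L (D x) y = φ (w x y) := by
      intro x y
      have : E (D x) = w.compr₂ φ x := by simp [D]
      have h2 := LinearMap.congr_fun this y
      rwa [LinearMap.BilinForm.toDual_def] at h2
    let DD : LieDerivation k L L :=
      { toLinearMap := D
        leibniz' := by
          intro a b
          rw [← sub_eq_zero]
          apply hnd.1
          intro y
          have := congrArg φ (hc a b y)
          have h3 : w ⁅a, y⁆ b = - w b ⁅a, y⁆ := by
            have := ha (b + ⁅a, y⁆)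
            simp only [map_add, LinearMap.add_apply, ha] at this
            rw [eq_neg_iff_add_eq_zero, ← this]
            abel
          simp only [ht, h3, map_sub, map_add, map_neg, map_zero] at this
          simp only [map_sub, LinearMap.sub_apply, traceForm_apply_lie_apply', hD]
          linear_combination -this }
    obtain ⟨z, hz⟩ := LieDerivation.IsKilling.exists_eq_ad DD
    refine ⟨z, fun x y => ?_⟩
    have : DD x = ⁅z, x⁆ := by rw [← hz]; simp
    rw [← hD, ← traceForm_apply_lie_apply, ← this]
    rfl
  let b := Module.finBasis k V
  choose z hz using fun i => hsc (b.coord i)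
  refine ⟨-∑ i, (killingForm k L (z i)).smulRight (b i), fun x y => ?_⟩
  simp only [ht, LinearMap.neg_apply, LinearMap.sum_apply, LinearMap.smulRight_apply, ← hz]
  simp [b.sum_repr]

variable [CharZero k] [FiniteDimensional k V]

theorem traceForm_ne (hnt : ¬ ∀ (x : L) (v : V), ⁅x, v⁆ = 0) : traceForm k L V ≠ 0 := by
  intro h0
  apply hnt
  have hn := isNilpotent_derivedSeries_of_traceForm_eq_zero h0
  have hn' : LieModule.IsNilpotent L V := by
    rw [isNilpotent_iff_forall' (R := k)] at hn ⊢
    intro x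
    have hx : x ∈ derivedSeries k L 1 := by
      have hD : (derivedSeries k L 1).toSubmodule
          = Submodule.span k {m : L | ∃ y z : L, ⁅y, z⁆ = m} := by
        rw [derivedSeries_def, derivedSeriesOfIdeal_succ, derivedSeriesOfIdeal_zero,
          LieSubmodule.lieIdeal_oper_eq_linear_span]
        congr 1
        ext m
        simp
      rw [perfect] at hD
      rw [← LieSubmodule.mem_toSubmodule, hD]
      trivial
    exact hn ⟨x, hx⟩
  have step : ∀ n, ∀ (x : L) (v : V), ⁅x, v⁆ ∈ lowerCentralSeries k L V n := by
    intro n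
    induction n with
    | zero => simp
    | succ n ih =>
      intro x v
      rw [lowerCentralSeries_succ]
      have hx : x ∈ Submodule.span k {m : L | ∃ y z : L, ⁅y, z⁆ = m} := by rw [perfect]; trivial
      induction hx using Submodule.span_induction with
      | mem x h =>
        obtain ⟨y, z, rfl⟩ := h
        rw [lie_lie]
        exact sub_mem (LieSubmodule.lie_mem_lie (by simp) (ih _ _))
          (LieSubmodule.lie_mem_lie (by simp) (ih _ _))
      | zero => simp
      | add x y _ _ hx hy => rw [add_lie]; exact add_mem hx hy
      | smul a x _ hx => rw [smul_lie]; exact Submodule.smul_mem _ a hx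
  obtain ⟨n, hn⟩ := IsNilpotent.nilpotent k L V
  intro x v
  have := step n x v
  rwa [hn, LieSubmodule.mem_bot] at this

theorem exists_casimir (hnt : ¬ ∀ (x : L) (v : V), ⁅x, v⁆ = 0) :
    ∃ (n : ℕ) (e f : Fin n → L), Inv k e f V ∧ cas (k := k) e f V ≠ 0 := by
  let β := traceForm k L V
  let R : LieIdeal k L := InvariantForm.orthogonal β (traceForm_lieInvariant k L V) ⊤
  have hR : ∀ x, x ∈ R ↔ ∀ y, β x y = 0 := by
    intro x
    rw [InvariantForm.mem_orthogonal]
    simp only [LieSubmodule.mem_top, true_imp_iff]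
    exact forall_congr' fun y => by rw [traceForm_comm]
  let I : LieIdeal k L := R.killingCompl
  have hc : IsCompl R I := LieIdeal.isCompl_killingCompl R
  have hdec : ∀ x, ∃ r ∈ R, ∃ i ∈ I, r + i = x := by
    intro x
    have : x ∈ R ⊔ I := by rw [hc.sup_eq_top]; simp
    exact LieSubmodule.mem_sup _ _ _ |>.1 this
  let B : LinearMap.BilinForm k I := β.restrict I.toSubmodule
  have hB : ∀ x y : I, B x y = β x y := fun _ _ => rfl
  have hsymm : B.IsSymm := ⟨fun x y => by rw [hB, hB]; exact traceForm_comm ..⟩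
  have hsep : ∀ x : I, (∀ y, B x y = 0) → x = 0 := by
    intro x hx
    have hxR : (x : L) ∈ R := by
      rw [hR]
      intro y
      obtain ⟨r, hr, i, hi, rfl⟩ := hdec y
      have h1 : β x r = 0 := by
        have := (hR r).1 hr x
        rwa [traceForm_comm] at this
      have h2 := hx ⟨i, hi⟩
      rw [hB] at h2
      rw [map_add, h1, h2, add_zero]
    have : (x : L) ∈ R ⊓ I := ⟨hxR, x.2⟩
    rw [hc.inf_eq_bot, LieSubmodule.mem_bot] at this
    exact Subtype.ext this
  have hnd : B.Nondegenerate := by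
    refine ⟨hsep, fun x hx => hsep x fun y => ?_⟩
    rw [hB, traceForm_comm]
    exact hx y
  let b := Module.finBasis k I
  let d := B.dualBasis hnd b
  have hb : ∀ x : I, ∑ i, B x (d i) • b i = x := by
    intro x
    conv_rhs => rw [← b.sum_repr x]
    refine Finset.sum_congr rfl fun i _ => ?_
    congr 1
    have := LinearMap.BilinForm.dualBasis_repr_apply hnd d x i
    rwa [LinearMap.BilinForm.dualBasis_dualBasis hnd hsymm, eq_comm] at this
  have hd : ∀ x : I, ∑ i, B x (b i) • d i = x := by
    intro x
    conv_rhs => rw [← d.sum_repr x]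
    refine Finset.sum_congr rfl fun i _ => ?_
    rw [LinearMap.BilinForm.dualBasis_repr_apply]
  refine ⟨_, fun i => b i, fun i => d i, ?_, ?_⟩
  · intro F x
    have h1 : ∀ i, ⁅x, (b i : L)⁆ = ∑ j, β ⁅x, (b i : L)⁆ (d j) • (b j : L) := by
      intro i
      have := congrArg (fun t : I => (t : L)) (hb ⁅x, b i⁆)
      simpa [hB] using this.symm
    have h2 : ∀ i, ⁅x, (d i : L)⁆ = ∑ j, β ⁅x, (d i : L)⁆ (b j) • (d j : L) := by
      intro i
      have := congrArg (fun t : I => (t : L)) (hd ⁅x, d i⁆)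
      simpa [hB] using this.symm
    rw [Finset.sum_add_distrib]
    have h3 : ∑ i, F ⁅x, (b i : L)⁆ (d i) = ∑ i, ∑ j, β ⁅x, (b i : L)⁆ (d j) • F (b j) (d i) := by
      refine Finset.sum_congr rfl fun i _ => ?_
      conv_lhs => rw [h1 i]
      simp only [map_sum, LinearMap.sum_apply, map_smul, LinearMap.smul_apply]
    have h4 : ∑ i, F (b i : L) ⁅x, (d i : L)⁆ = ∑ i, ∑ j, β ⁅x, (d i : L)⁆ (b j) • F (b i) (d j) := by
      refine Finset.sum_congr rfl fun i _ => ?_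
      conv_lhs => rw [h2 i]
      simp only [map_sum, map_smul]
    rw [h3, h4, Finset.sum_comm, ← Finset.sum_add_distrib]
    refine Finset.sum_eq_zero fun i _ => ?_
    rw [← Finset.sum_add_distrib]
    refine Finset.sum_eq_zero fun j _ => ?_
    rw [← add_smul, traceForm_apply_lie_apply', traceForm_comm, neg_add_cancel, zero_smul]
  · intro h0
    have htr := congrArg (LinearMap.trace k V) h0
    have h1 : ∀ i, LinearMap.trace k V (toEnd k L V (b i) ∘ₗ toEnd k L V (d i)) = 1 := by
      intro i
      have := LinearMap.BilinForm.apply_dualBasis_right hnd hsymm b i i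
      rw [if_pos rfl] at this
      exact this
    rw [cas, map_sum, map_zero] at htr
    simp only [h1, Finset.sum_const, Finset.card_univ, Fintype.card_fin, nsmul_eq_mul, mul_one,
      Nat.cast_eq_zero] at htr
    have hsub : Subsingleton I := Module.finrank_zero_iff.1 htr
    apply traceForm_ne hnt (k := k)
    ext x y
    obtain ⟨r, hr, i, hi, rfl⟩ := hdec x
    have hi0 : i = 0 := congrArg Subtype.val (Subsingleton.elim (⟨i, hi⟩ : I) 0)
    rw [hi0, add_zero]
    exact (hR r).1 hr y

end killing

theorem main (k : Type*) [Field k] [CharZero k]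
    (L : Type*) [LieRing L] [LieAlgebra k L] [FiniteDimensional k L] [IsKilling k L] (n : ℕ) :
    ∀ (V : Type*) [AddCommGroup V] [Module k V] [LieRingModule L V] [LieModule k L V]
    [FiniteDimensional k V], Module.finrank k V = n → H1 k L V ∧ H2 k L V := by
  induction n using Nat.strong_induction_on with
  | _ n ih =>
  intro V _ _ _ _ _ hn
  by_cases ht : ∀ (x : L) (v : V), ⁅x, v⁆ = 0
  · exact ⟨H1_triv ht, H2_triv ht⟩
  obtain ⟨m, e, f, hI, h0⟩ := exists_casimir (k := k) ht
  let c := cas (k := k) e f V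
  let W : LieSubmodule k L V :=
    { LinearMap.ker c with
      lie_mem := by
        intro x v hv
        have hv' : c v = 0 := hv
        change c ⁅x, v⁆ = 0
        rw [cas_comm hI, hv', lie_zero] }
  have hW : W.toSubmodule = LinearMap.ker c := rfl
  by_cases hb : LinearMap.ker c = ⊥
  · have hbij : Function.Bijective c :=
      ⟨LinearMap.ker_eq_bot.1 hb, LinearMap.injective_iff_surjective.1 (LinearMap.ker_eq_bot.1 hb)⟩
    exact ⟨H1_cas hI hbij, H2_cas hI hbij⟩
  · have hlt : Module.finrank k W < n := by
      rw [← hn]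
      apply Submodule.finrank_lt (s := W.toSubmodule)
      rw [hW]
      intro h
      exact h0 (LinearMap.ker_eq_top.1 h)
    have hpos : 0 < Module.finrank k W := by
      rw [Nat.pos_iff_ne_zero]
      intro h
      exact hb (Submodule.finrank_eq_zero.1 h)
    have hq : Module.finrank k (V ⧸ W) < n := by
      have := Submodule.finrank_quotient_add_finrank W.toSubmodule
      have h2 : Module.finrank k (V ⧸ W) = Module.finrank k (V ⧸ W.toSubmodule) := rfl
      have h3 : Module.finrank k W = Module.finrank k W.toSubmodule := rfl
      omega
    have a1 := ih _ hlt W rfl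
    have a2 := ih _ hq (V ⧸ W) rfl
    exact ⟨H1_ext W a1.1 a2.1, H2_ext W a1.2 a2.2⟩

section unfold

variable (k) (F1 : (Fin 1 → L) → V) (F2 : (Fin 2 → L) → V)

theorem ceD_one (x y : L) : ceD k L V 1 F1 ![x, y] =
    ⁅x, F1 ![y]⁆ - ⁅y, F1 ![x]⁆ - F1 ![⁅x, y⁆] := by
  have a0 : (fun j => ![x, y] ((0 : Fin (1 + 1)).succAbove j)) = ![y] := by
    ext i; fin_cases i; rfl
  have a1 : (fun j => ![x, y] ((1 : Fin (1 + 1)).succAbove j)) = ![x] := by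
    ext i; fin_cases i; rfl
  have u (h : ((0 : Fin (1 + 1)) : ℕ) < 1) : Function.update ![x]
      (⟨((0 : Fin (1 + 1)) : ℕ), h⟩ : Fin 1) ⁅x, y⁆ = ![⁅x, y⁆] := by
    ext i; fin_cases i; rfl
  have b0 : ![x, y] (0 : Fin (1 + 1)) = x := rfl
  have b1 : ![x, y] (1 : Fin (1 + 1)) = y := rfl
  have s2 : ∀ G : Fin (1 + 1) → V, ∑ i, G i = G 0 + G 1 := Fin.sum_univ_two
  simp only [ceD, s2]
  rw [dif_neg (show ¬ ((0 : Fin (1 + 1)) : ℕ) < ((0 : Fin (1 + 1)) : ℕ) by decide),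
    dif_neg (show ¬ ((1 : Fin (1 + 1)) : ℕ) < ((0 : Fin (1 + 1)) : ℕ) by decide),
    dif_pos (show ((0 : Fin (1 + 1)) : ℕ) < ((1 : Fin (1 + 1)) : ℕ) by decide),
    dif_neg (show ¬ ((1 : Fin (1 + 1)) : ℕ) < ((1 : Fin (1 + 1)) : ℕ) by decide), a0, a1, b0, b1, u]
  have p0 : (-1 : k) ^ ((0 : Fin (1 + 1)) : ℕ) = 1 := pow_zero _
  have p1 : (-1 : k) ^ ((1 : Fin (1 + 1)) : ℕ) = -1 := pow_one _
  rw [p0, p1, one_smul, neg_one_smul, neg_one_smul]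
  abel

theorem ceD_two (x y z : L) : ceD k L V 2 F2 ![x, y, z] =
    ⁅x, F2 ![y, z]⁆ - ⁅y, F2 ![x, z]⁆ + ⁅z, F2 ![x, y]⁆ - F2 ![⁅x, y⁆, z] + F2 ![⁅x, z⁆, y]
      + F2 ![x, ⁅y, z⁆] := by
  have a0 : (fun j => ![x, y, z] ((0 : Fin (2 + 1)).succAbove j)) = ![y, z] := by
    ext i; fin_cases i <;> rfl
  have a1 : (fun j => ![x, y, z] ((1 : Fin (2 + 1)).succAbove j)) = ![x, z] := by
    ext i; fin_cases i <;> rfl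
  have a2 : (fun j => ![x, y, z] ((2 : Fin (2 + 1)).succAbove j)) = ![x, y] := by
    ext i; fin_cases i <;> rfl
  have u0 (p q r : L) (h : ((0 : Fin (2 + 1)) : ℕ) < 2) : Function.update ![p, q]
      (⟨((0 : Fin (2 + 1)) : ℕ), h⟩ : Fin 2) r = ![r, q] := by
    ext i; fin_cases i <;> rfl
  have u1 (p q r : L) (h : ((1 : Fin (2 + 1)) : ℕ) < 2) : Function.update ![p, q]
      (⟨((1 : Fin (2 + 1)) : ℕ), h⟩ : Fin 2) r = ![p, r] := by
    ext i; fin_cases i <;> rfl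
  have b0 : ![x, y, z] (0 : Fin (2 + 1)) = x := rfl
  have b1 : ![x, y, z] (1 : Fin (2 + 1)) = y := rfl
  have b2 : ![x, y, z] (2 : Fin (2 + 1)) = z := rfl
  have s3 : ∀ G : Fin (2 + 1) → V, ∑ i, G i = G 0 + G 1 + G 2 := Fin.sum_univ_three
  simp only [ceD, s3]
  rw [dif_neg (show ¬ ((0 : Fin (2 + 1)) : ℕ) < ((0 : Fin (2 + 1)) : ℕ) by decide),
    dif_neg (show ¬ ((1 : Fin (2 + 1)) : ℕ) < ((0 : Fin (2 + 1)) : ℕ) by decide),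
    dif_neg (show ¬ ((2 : Fin (2 + 1)) : ℕ) < ((0 : Fin (2 + 1)) : ℕ) by decide),
    dif_pos (show ((0 : Fin (2 + 1)) : ℕ) < ((1 : Fin (2 + 1)) : ℕ) by decide),
    dif_neg (show ¬ ((1 : Fin (2 + 1)) : ℕ) < ((1 : Fin (2 + 1)) : ℕ) by decide),
    dif_neg (show ¬ ((2 : Fin (2 + 1)) : ℕ) < ((1 : Fin (2 + 1)) : ℕ) by decide),
    dif_pos (show ((0 : Fin (2 + 1)) : ℕ) < ((2 : Fin (2 + 1)) : ℕ) by decide),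
    dif_pos (show ((1 : Fin (2 + 1)) : ℕ) < ((2 : Fin (2 + 1)) : ℕ) by decide),
    dif_neg (show ¬ ((2 : Fin (2 + 1)) : ℕ) < ((2 : Fin (2 + 1)) : ℕ) by decide),
    a0, a1, a2, b0, b1, b2, u0, u0, u1]
  have p0 : (-1 : k) ^ ((0 : Fin (2 + 1)) : ℕ) = 1 := pow_zero _
  have p1 : (-1 : k) ^ ((1 : Fin (2 + 1)) : ℕ) = -1 := pow_one _
  have p2 : (-1 : k) ^ ((2 : Fin (2 + 1)) : ℕ) = 1 := neg_one_sq
  rw [p0, p1, p2]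
  simp only [one_smul, neg_one_smul]
  abel

end unfold

end Whitehead

/-- Whitehead's lemmas: for a finite-dimensional semisimple Lie algebra `L` (nondegenerate
Killing form) over a field of characteristic 0 and a finite-dimensional module `V`, the
first and second Chevalley–Eilenberg cohomology groups vanish: every 1-cocycle is the
differential of a 0-cochain, and every 2-cocycle is the differential of a 1-cochain. -/
theorem stmt_6 (k : Type*) [Field k] [CharZero k]
    (L : Type*) [LieRing L] [LieAlgebra k L] [FiniteDimensional k L]
    [LieAlgebra.IsKilling k L]
    (V : Type*) [AddCommGroup V] [Module k V] [LieRingModule L V] [LieModule k L V]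
    [FiniteDimensional k V] :
    (∀ ω : AlternatingMap k L V (Fin 1), ceD k L V 1 ⇑ω = 0 →
      ∃ v : V, ⇑ω = ceD k L V 0 (fun _ => v)) ∧
    (∀ ω : AlternatingMap k L V (Fin 2), ceD k L V 2 ⇑ω = 0 →
      ∃ η : AlternatingMap k L V (Fin 1), ⇑ω = ceD k L V 1 ⇑η) := by
  obtain ⟨h1, h2⟩ := Whitehead.main k L _ V rfl
  constructor
  · intro ω hω
    let f : L →ₗ[k] V :=
      { toFun := fun x => ω ![x]
        map_add' := fun x y => ω.map_vecCons_add ![] x y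
        map_smul' := fun a x => ω.map_vecCons_smul ![] a x }
    have hf : ∀ x, ω ![x] = f x := fun x => rfl
    obtain ⟨v, hv⟩ := h1 f (by
      intro x y
      have := congrFun hω ![x, y]
      rw [Whitehead.ceD_one, hf, hf, hf] at this
      exact (sub_eq_zero.1 this).symm)
    refine ⟨v, ?_⟩
    ext x
    have hx : x = ![x 0] := by ext i; fin_cases i; rfl
    have : ω x = f (x 0) := by rw [← hf, ← hx]
    rw [this, hv]
    simp [ceD]
  · intro ω hω
    have hvec : ∀ x : Fin 2 → L, x = ![x 0, x 1] := by
      intro x; ext i; fin_cases i <;> rfl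
    have hsw : ∀ x y, ω ![x, y] = - ω ![y, x] := by
      intro x y
      have := ω.map_swap ![y, x] (i := 0) (j := 1) (by decide)
      rw [← this]
      congr 1
      ext i; fin_cases i <;> simp
    have hadd : ∀ x x' y, ω ![x + x', y] = ω ![x, y] + ω ![x', y] :=
      fun x x' y => ω.map_vecCons_add ![y] x x'
    have hsm : ∀ (a : k) x y, ω ![a • x, y] = a • ω ![x, y] :=
      fun a x y => ω.map_vecCons_smul ![y] a x
    let w : L →ₗ[k] L →ₗ[k] V := LinearMap.mk₂ k (fun x y => ω ![x, y]) hadd hsm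
      (fun x y y' => by rw [hsw, hadd, hsw x y, hsw x y']; abel)
      (fun a x y => by rw [hsw, hsm, hsw x y, smul_neg])
    have hw : ∀ x y, ω ![x, y] = w x y := fun x y => rfl
    have hwa : ∀ x, w x x = 0 := fun x =>
      ω.map_eq_zero_of_eq ![x, x] (i := 0) (j := 1) rfl (by decide)
    obtain ⟨g, hg⟩ := h2 w hwa (by
      intro x y z
      have := congrFun hω ![x, y, z]
      rw [Whitehead.ceD_two] at this
      exact this)
    refine ⟨(AlternatingMap.ofSubsingleton k L V (0 : Fin 1)) g, ?_⟩
    ext x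
    rw [hvec x, hw, hg, Whitehead.ceD_one]
    rfl
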